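/- arXiv:2503.09525 — 2 statements merged into one kernel-verified Lean document; each statement's English description precedes it below -/
import Mathlib

section
/- Let d ≥ 1 and n ≥ 1 be natural numbers. Let f : ℝ^d → ℝ be a continuous function and suppose there exist n pairwise distinct affine functions f_1, …, f_n : ℝ^d → ℝ such that for every x ∈ ℝ^d there is some i ∈ {1,…,n} with f(x) = f_i(x). Then there exists a finite family 𝒫 of open convex subsets of ℝ^d with cardinality |𝒫| ≤ min( Σ_{i=0}^{d} C(n(n−1)/2, i), n! ), such that ℝ^d = ⋃_{P ∈ 𝒫} closure(P) and f is affine on each P ∈ 𝒫, where C(·,·) denotes the binomial coefficient. -/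
/-- An affine function `ℝ^d → ℝ`, i.e. a map of the form `x ↦ ⟨a, x⟩ + b`. -/
def IsAffineFn {d : ℕ} (g : (Fin d → ℝ) → ℝ) : Prop :=
  ∃ (a : Fin d → ℝ) (b : ℝ), ∀ x, g x = (∑ i, a i * x i) + b

/-- `f` agrees with some affine map on the set `P`. -/
def AffineOnSet {d : ℕ} (f : (Fin d → ℝ) → ℝ) (P : Set (Fin d → ℝ)) : Prop :=
  ∃ g : (Fin d → ℝ) → ℝ, IsAffineFn g ∧ ∀ x ∈ P, f x = g x

/-- `Ps` is an admissible (finite) set of pieces for `f`: all pieces are open,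
connected, `f` is affine on each of them, and their closures cover `ℝ^d`. -/
def IsPieceSet {d : ℕ} (f : (Fin d → ℝ) → ℝ) (Ps : Finset (Set (Fin d → ℝ))) : Prop :=
  (∀ P ∈ Ps, IsOpen P ∧ IsConnected P ∧ AffineOnSet f P) ∧
    (⋃ P ∈ Ps, closure P) = Set.univ

/-- A continuous piecewise affine (CPA) function. -/
def IsCPA {d : ℕ} (f : (Fin d → ℝ) → ℝ) : Prop :=
  Continuous f ∧ ∃ Ps : Finset (Set (Fin d → ℝ)), IsPieceSet f Ps

/-- `P` is a maximal piece of `f`: open, connected, `f` affine on `P`, and it cannot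
be enlarged by a nonempty set `U ⊆ ℝ^d \ P` keeping openness, connectedness and affineness. -/
def IsMaximalPiece {d : ℕ} (f : (Fin d → ℝ) → ℝ) (P : Set (Fin d → ℝ)) : Prop :=
  IsOpen P ∧ IsConnected P ∧ AffineOnSet f P ∧
    ¬ ∃ U : Set (Fin d → ℝ), U.Nonempty ∧ U ⊆ Pᶜ ∧ IsOpen (P ∪ U) ∧
      IsConnected (P ∪ U) ∧ AffineOnSet f (P ∪ U)

namespace IsAffineFn

variable {d : ℕ} {g h : (Fin d → ℝ) → ℝ}

lemma sub (hg : IsAffineFn g) (hh : IsAffineFn h) : IsAffineFn (fun x => g x - h x) := by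
  obtain ⟨a, b, hab⟩ := hg
  obtain ⟨a', b', hab'⟩ := hh
  refine ⟨a - a', b - b', fun x => ?_⟩
  simp only [hab, hab', Pi.sub_apply, sub_mul, Finset.sum_sub_distrib]
  ring

lemma continuous (hg : IsAffineFn g) : Continuous g := by
  obtain ⟨a, b, hab⟩ := hg
  rw [funext hab]
  fun_prop

lemma map_combo (hg : IsAffineFn g) {s t : ℝ} (hst : s + t = 1) (x y : Fin d → ℝ) :
    g (s • x + t • y) = s * g x + t * g y := by
  obtain ⟨a, b, hab⟩ := hg
  have hsum : ∑ i, a i * (s • x + t • y) i = s * ∑ i, a i * x i + t * ∑ i, a i * y i := by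
    simp only [Finset.mul_sum, ← Finset.sum_add_distrib]
    refine Finset.sum_congr rfl fun i _ => ?_
    simp only [Pi.add_apply, Pi.smul_apply, smul_eq_mul]
    ring
  rw [hab, hab, hab, hsum]
  linear_combination (-b) * hst

lemma convex_pos (hg : IsAffineFn g) : Convex ℝ {x | 0 < g x} := by
  intro x hx y hy s t hs ht hst
  rw [Set.mem_ofPred_eq] at *
  rw [hg.map_combo hst]
  rcases hs.eq_or_lt with rfl | hs
  · have : t = 1 := by linarith
    simpa [this] using hy
  · have := mul_pos hs hx
    have := mul_nonneg ht hy.le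
    linarith

lemma convex_neg (hg : IsAffineFn g) : Convex ℝ {x | g x < 0} := by
  have h0 : IsAffineFn (fun _ : Fin d → ℝ => (0 : ℝ)) := ⟨0, 0, by simp⟩
  simpa using (h0.sub hg).convex_pos

/-- A nonzero affine function is nonzero on a dense set. -/
lemma dense_ne_zero (hg : IsAffineFn g) (h0 : ∃ y, g y ≠ 0) : Dense {x | g x ≠ 0} := by
  obtain ⟨y, hy⟩ := h0
  intro x
  by_cases hx : g x = 0
  · have hlim : Filter.Tendsto (fun t : ℝ => (1 - t) • x + t • y) (nhdsWithin 0 {0}ᶜ)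
        (nhds x) := by
      have hcont : Continuous fun t : ℝ => (1 - t) • x + t • y := by fun_prop
      simpa using (hcont.tendsto 0).mono_left nhdsWithin_le_nhds
    refine mem_closure_of_tendsto hlim ?_
    filter_upwards [self_mem_nhdsWithin] with t ht
    have ht' : t ≠ 0 := ht
    change g _ ≠ 0
    rw [hg.map_combo (by ring), hx]
    simpa using ⟨ht', hy⟩
  · exact subset_closure hx

end IsAffineFn

section Arrangement

variable {d : ℕ} {α : Type*}

/-- The open region of the arrangement `g` on which exactly the functions indexed by `A` are
positive and all the others are negative. -/
def chamber (g : α → (Fin d → ℝ) → ℝ) (A : Finset α) : Set (Fin d → ℝ) :=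
  {x | ∀ k, (k ∈ A → 0 < g k x) ∧ (k ∉ A → g k x < 0)}

lemma chamber_eq_iInter (g : α → (Fin d → ℝ) → ℝ) (A : Finset α) [DecidableEq α] :
    chamber g A = ⋂ k, if k ∈ A then {x | 0 < g k x} else {x | g k x < 0} := by
  ext x
  simp only [chamber, Set.mem_ofPred_eq, Set.mem_iInter]
  refine forall_congr' fun k => ?_
  by_cases hk : k ∈ A <;> simp [hk]

lemma mem_iff_pos_of_mem_chamber {g : α → (Fin d → ℝ) → ℝ} {A : Finset α} {x : Fin d → ℝ}
    (hx : x ∈ chamber g A) (k : α) : k ∈ A ↔ 0 < g k x :=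
  ⟨(hx k).1, fun hpos => by_contra fun hk => lt_asymm hpos ((hx k).2 hk)⟩

lemma ne_zero_of_mem_chamber {g : α → (Fin d → ℝ) → ℝ} {A : Finset α} {x : Fin d → ℝ}
    (hx : x ∈ chamber g A) (k : α) : g k x ≠ 0 := by
  by_cases hk : k ∈ A
  · exact ((hx k).1 hk).ne'
  · exact ((hx k).2 hk).ne

lemma convex_chamber {g : α → (Fin d → ℝ) → ℝ} (hg : ∀ k, IsAffineFn (g k)) (A : Finset α) :
    Convex ℝ (chamber g A) := by
  classical
  rw [chamber_eq_iInter]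
  refine convex_iInter fun k => ?_
  split_ifs
  · exact (hg k).convex_pos
  · exact (hg k).convex_neg

lemma isOpen_chamber [Finite α] {g : α → (Fin d → ℝ) → ℝ} (hg : ∀ k, IsAffineFn (g k))
    (A : Finset α) : IsOpen (chamber g A) := by
  classical
  rw [chamber_eq_iInter]
  refine isOpen_iInter_of_finite fun k => ?_
  split_ifs
  · exact isOpen_lt continuous_const (hg k).continuous
  · exact isOpen_lt (hg k).continuous continuous_const

variable [Fintype α]

open Classical in
/-- The sign patterns of the nonempty chambers of the arrangement `g`. -/
noncomputable def chamberPatterns (g : α → (Fin d → ℝ) → ℝ) : Finset (Finset α) :=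
  Finset.univ.filter fun A => (chamber g A).Nonempty

lemma mem_chamberPatterns {g : α → (Fin d → ℝ) → ℝ} {A : Finset α} :
    A ∈ chamberPatterns g ↔ (chamber g A).Nonempty := by
  simp [chamberPatterns]

lemma iUnion_closure_chamber {g : α → (Fin d → ℝ) → ℝ} (hg : ∀ k, IsAffineFn (g k))
    (h0 : ∀ k, ∃ y, g k y ≠ 0) : (⋃ A ∈ chamberPatterns g, closure (chamber g A)) = Set.univ := by
  classical
  have hdense : Dense (⋂ k, {x | g k x ≠ 0}) :=
    dense_iInter_of_isOpen (fun k => isOpen_ne_fun (hg k).continuous continuous_const)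
      fun k => (hg k).dense_ne_zero (h0 k)
  rw [← Finset.closure_biUnion, ← dense_iff_closure_eq]
  refine hdense.mono fun x hx => ?_
  have hmem : x ∈ chamber g (Finset.univ.filter fun k => 0 < g k x) := fun k => by
    have hk : g k x ≠ 0 := Set.mem_iInter.1 hx k
    simpa using fun hle => lt_of_le_of_ne hle hk
  exact Set.mem_biUnion (mem_chamberPatterns.2 ⟨x, hmem⟩) hmem

lemma card_le_of_shatters_chamberPatterns [DecidableEq α] {g : α → (Fin d → ℝ) → ℝ}
    (hg : ∀ k, IsAffineFn (g k)) {S : Finset α} (hS : (chamberPatterns g).Shatters S) :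
    S.card ≤ d := by
  by_contra! hlt
  choose a b hab using hg
  have key : ∀ c : S → ℝ, ∑ k, c k • a k = 0 → (∃ k, c k ≠ 0) → 0 < ∑ k, c k * b k := by
    rintro c hc ⟨k₀, hk₀⟩
    obtain ⟨A, hA, hSA⟩ := hS (t := (Finset.univ.filter fun k => 0 < c k).map
      (Function.Embedding.subtype _)) fun k hk => by
        obtain ⟨k', -, rfl⟩ := Finset.mem_map.1 hk
        exact k'.2
    obtain ⟨x, hx⟩ := mem_chamberPatterns.1 hA
    have hiff : ∀ k : S, (k : α) ∈ A ↔ 0 < c k := fun k => by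
      have := Finset.ext_iff.1 hSA k
      simpa using this
    have hpos : ∀ k : S, c k ≠ 0 → 0 < c k * g k x := fun k hk => by
      rcases hk.lt_or_gt with hneg | hpos
      · exact mul_pos_of_neg_of_neg hneg ((hx k).2 fun hkA => lt_asymm hneg ((hiff k).1 hkA))
      · exact mul_pos hpos ((hx k).1 ((hiff k).2 hpos))
    have hlin : ∑ k, c k * ∑ i, a k i * x i = 0 := by
      calc ∑ k, c k * ∑ i, a k i * x i = ∑ i, (∑ k, c k • a k) i * x i := by
            simp only [Finset.sum_apply, Pi.smul_apply, smul_eq_mul, Finset.mul_sum,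
              Finset.sum_mul]
            rw [Finset.sum_comm]
            simp only [mul_assoc]
        _ = 0 := by rw [hc]; simp
    calc 0 < ∑ k, c k * g k x := by
          refine Finset.sum_pos' (fun k _ => ?_) ⟨k₀, Finset.mem_univ _, hpos k₀ hk₀⟩
          by_cases hk : c k = 0
          · simp [hk]
          · exact (hpos k hk).le
      _ = ∑ k, c k * b k := by
          simp only [hab, mul_add, Finset.sum_add_distrib, hlin, zero_add]
  have hdep : ¬ LinearIndependent ℝ fun k : S => a k := fun hli => by
    have := hli.fintype_card_le_finrank
    simp at this
    omega
  obtain ⟨c, hc, hc₀⟩ := Fintype.not_linearIndependent_iff.1 hdep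
  have hpos := key c hc hc₀
  have hneg := key (-c) (by simp only [Pi.neg_apply, neg_smul, Finset.sum_neg_distrib, hc, neg_zero])
    (by simpa using hc₀)
  simp only [Pi.neg_apply, neg_mul, Finset.sum_neg_distrib] at hneg
  linarith

/-- The number of chambers of an arrangement of `m` affine functions on `ℝ^d` is at most
`∑ i ≤ d, m.choose i`. -/
lemma card_chamberPatterns_le {g : α → (Fin d → ℝ) → ℝ} (hg : ∀ k, IsAffineFn (g k)) :
    (chamberPatterns g).card ≤ ∑ i ∈ Finset.range (d + 1), (Fintype.card α).choose i := by
  classical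
  have hvc : (chamberPatterns g).vcDim ≤ d :=
    Finset.sup_le fun S hS =>
      card_le_of_shatters_chamberPatterns hg (Finset.mem_shatterer.1 hS)
  calc (chamberPatterns g).card ≤ (chamberPatterns g).shatterer.card :=
        Finset.card_le_card_shatterer _
    _ ≤ ∑ i ∈ Finset.Iic (chamberPatterns g).vcDim, (Fintype.card α).choose i :=
        Finset.card_shatterer_le_sum_vcDim
    _ ≤ ∑ i ∈ Finset.range (d + 1), (Fintype.card α).choose i :=
        Finset.sum_le_sum_of_subset fun i hi => by
          rw [Finset.mem_Iic] at hi
          exact Finset.mem_range.2 (by omega)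

end Arrangement

section PairwiseDifferences

variable {d n : ℕ}

/-- The differences `F i - F j` for `i < j`, whose zero sets form the arrangement on whose
chambers the order of the values `F i x` is constant. -/
def pairDiff (F : Fin n → (Fin d → ℝ) → ℝ) (k : Σ j : Fin n, Fin j) (x : Fin d → ℝ) : ℝ :=
  F (k.2.castLE k.1.2.le) x - F k.1 x

lemma card_pairs : Fintype.card (Σ j : Fin n, Fin j) = n * (n - 1) / 2 := by
  simp only [Fintype.card_sigma, Fintype.card_fin]
  rw [Fin.sum_univ_eq_sum_range (fun j => j) n, Finset.sum_range_id]

lemma pair_ne (k : Σ j : Fin n, Fin j) : k.2.castLE k.1.2.le ≠ k.1 := by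
  rw [Ne, Fin.ext_iff, Fin.val_castLE]
  exact k.2.2.ne

lemma injective_of_pairDiff_ne_zero {F : Fin n → (Fin d → ℝ) → ℝ} {x : Fin d → ℝ}
    (hx : ∀ k, pairDiff F k x ≠ 0) : Function.Injective fun i => F i x := by
  have hlt : ∀ i j : Fin n, i < j → F i x ≠ F j x := fun i j hij =>
    sub_ne_zero.1 (hx ⟨j, ⟨i, hij⟩⟩)
  intro i j hij
  by_contra hne
  rcases lt_or_gt_of_ne hne with h | h
  · exact hlt i j h hij
  · exact hlt j i h hij.symm

lemma lt_iff_sort_symm_lt {v : Fin n → ℝ} (hv : Function.Injective v) (i j : Fin n) :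
    v i < v j ↔ (Tuple.sort v).symm i < (Tuple.sort v).symm j := by
  have hmono : StrictMono (v ∘ Tuple.sort v) :=
    (Tuple.monotone_sort v).strictMono_of_injective (hv.comp (Tuple.sort v).injective)
  rw [← hmono.lt_iff_lt]
  simp

lemma card_chamberPatterns_pairDiff_le (F : Fin n → (Fin d → ℝ) → ℝ) :
    (chamberPatterns (pairDiff F)).card ≤ n.factorial := by
  classical
  have hx : ∀ A : chamberPatterns (pairDiff F), ∃ x, x ∈ chamber (pairDiff F) A.1 :=
    fun A => mem_chamberPatterns.1 A.2
  choose x hx using hx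
  have hinj : Function.Injective fun A => Tuple.sort fun i => F i (x A) := by
    intro A B hAB
    have hAB' : (Tuple.sort fun i => F i (x A)) = Tuple.sort fun i => F i (x B) := hAB
    ext k
    rw [mem_iff_pos_of_mem_chamber (hx A), mem_iff_pos_of_mem_chamber (hx B), pairDiff, pairDiff,
      sub_pos, sub_pos,
      lt_iff_sort_symm_lt (injective_of_pairDiff_ne_zero (ne_zero_of_mem_chamber (hx A))),
      lt_iff_sort_symm_lt (injective_of_pairDiff_ne_zero (ne_zero_of_mem_chamber (hx B))), hAB']
  simpa [Fintype.card_perm] using Fintype.card_le_of_injective _ hinj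

end PairwiseDifferences

/-- A continuous selection of finitely many continuous functions with pairwise distinct values
on a preconnected set coincides with one of them there. -/
lemma IsPreconnected.eqOn_of_continuous_selection {X ι : Type*} [TopologicalSpace X] [Finite ι]
    {C : Set X} (hC : IsPreconnected C) {f : X → ℝ} (hf : Continuous f) {F : ι → X → ℝ}
    (hF : ∀ i, Continuous (F i)) (hinj : ∀ x ∈ C, Function.Injective fun i => F i x)
    (hcover : ∀ x, ∃ i, f x = F i x) {x₀ : X} (hx₀ : x₀ ∈ C) : ∃ i, Set.EqOn f (F i) C := by
  obtain ⟨i, hi⟩ := hcover x₀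
  have hsub := isPreconnected_iff_subset_of_disjoint_closed.1 hC {x | f x = F i x}
    (⋃ j : {j // j ≠ i}, {x | f x = F j x}) (isClosed_eq hf (hF i))
    (isClosed_iUnion_of_finite fun j => isClosed_eq hf (hF j))
    (fun x _ => by
      obtain ⟨j, hj⟩ := hcover x
      by_cases hji : j = i
      · exact Or.inl (hji ▸ hj)
      · exact Or.inr (Set.mem_iUnion.2 ⟨⟨j, hji⟩, hj⟩))
    (by
      rw [Set.eq_empty_iff_forall_notMem]
      rintro x ⟨hxC, hxi, hxj⟩
      obtain ⟨⟨j, hji⟩, hj⟩ := Set.mem_iUnion.1 hxj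
      exact hji (hinj x hxC (hj.symm.trans hxi)))
  rcases hsub with h | h
  · exact ⟨i, h⟩
  · obtain ⟨⟨j, hji⟩, hj⟩ := Set.mem_iUnion.1 (h hx₀)
    exact absurd (hinj x₀ hx₀ (hj.symm.trans hi)) hji

/-- If a continuous `f : ℝ^d → ℝ` agrees everywhere with one of `n`
pairwise distinct affine functions, then there is a family of at most
`min (Σ_{i=0}^{d} C(n(n-1)/2, i)) (n!)` open convex pieces whose closures cover `ℝ^d`
and on each of which `f` is affine. -/
theorem cpa_upper_bound_chen {d n : ℕ} (hd : 1 ≤ d) (hn : 1 ≤ n)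
    (f : (Fin d → ℝ) → ℝ) (hf : Continuous f)
    (F : Fin n → (Fin d → ℝ) → ℝ) (hF : ∀ i, IsAffineFn (F i))
    (hdist : Function.Injective F)
    (hcover : ∀ x, ∃ i, f x = F i x) :
    ∃ Ps : Finset (Set (Fin d → ℝ)),
      Ps.card ≤ min (∑ i ∈ Finset.range (d + 1), Nat.choose (n * (n - 1) / 2) i)
        (Nat.factorial n) ∧
      (∀ P ∈ Ps, IsOpen P ∧ Convex ℝ P ∧ AffineOnSet f P) ∧
      (⋃ P ∈ Ps, closure P) = Set.univ := by
  classical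
  have hg : ∀ k, IsAffineFn (pairDiff F k) := fun k => (hF _).sub (hF _)
  have h0 : ∀ k, ∃ y, pairDiff F k y ≠ 0 := fun k => by
    obtain ⟨y, hy⟩ := Function.ne_iff.1 (hdist.ne (pair_ne k))
    exact ⟨y, sub_ne_zero.2 hy⟩
  refine ⟨(chamberPatterns (pairDiff F)).image (chamber (pairDiff F)),
    Finset.card_image_le.trans (le_min ?_ (card_chamberPatterns_pairDiff_le F)), ?_, ?_⟩
  · rw [← card_pairs]
    exact card_chamberPatterns_le hg
  · intro P hP
    obtain ⟨A, hA, rfl⟩ := Finset.mem_image.1 hP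
    obtain ⟨x₀, hx₀⟩ := mem_chamberPatterns.1 hA
    obtain ⟨i, hi⟩ := (convex_chamber hg A).isPreconnected.eqOn_of_continuous_selection hf
      (fun i => (hF i).continuous)
      (fun x hx => injective_of_pairDiff_ne_zero (ne_zero_of_mem_chamber hx)) hcover hx₀
    exact ⟨isOpen_chamber hg A, convex_chamber hg A, F i, hF i, hi⟩
  · rw [Finset.set_biUnion_finset_image]
    exact iUnion_closure_chamber hg h0
end

section
/- Let f : ℝ^d → ℝ be a CPA function having p pairwise distinct maximal pieces, and suppose there are real numbers z_min, z_max with z_min < inf_{x} f(x) ≤ sup_{x} f(x) < z_max. Let m ≥ 1 and let s : ℝ → ℝ be the m-sawtooth function between z_min and z_max. Then the function h : ℝ^{d+1} → ℝ defined by h(x, t) = min(f(x), s(t)) is CPA and has at least m · p pairwise distinct maximal pieces. -/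
/-- The `m`-sawtooth function between `zmin` and `zmax`: it linearly interpolates the
points `(i, zᵢ)` for `i = 0, …, 2m`, where `zᵢ = zmin` for even `i` and `zᵢ = zmax` for
odd `i`, and is extended linearly outside `[0, 2m]`. -/
noncomputable def sawtooth (m : ℕ) (zmin zmax : ℝ) (t : ℝ) : ℝ :=
  if t ≤ 0 then zmin + (zmax - zmin) * t
  else if (2 * m : ℝ) ≤ t then zmin + (zmax - zmin) * (2 * m - t)
  else zmin + (zmax - zmin) * (1 - |t - 2 * (⌊t / 2⌋ : ℝ) - 1|)

open Set Filter Topology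

section Affine

variable {d : ℕ}

lemma IsAffineFn.exists_affineMap {g : (Fin d → ℝ) → ℝ} (hg : IsAffineFn g) :
    ∃ A : (Fin d → ℝ) →ᵃ[ℝ] ℝ, g = A := by
  obtain ⟨a, b, h⟩ := hg
  refine ⟨(∑ i, a i • (LinearMap.proj i : (Fin d → ℝ) →ₗ[ℝ] ℝ)).toAffineMap +
    AffineMap.const ℝ _ b, ?_⟩
  funext x
  simp [h]

/-- Affine functions that agree on a nonempty open set are equal. -/
lemma IsAffineFn.eq_of_eqOn {g g' : (Fin d → ℝ) → ℝ} (hg : IsAffineFn g) (hg' : IsAffineFn g')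
    {V : Set (Fin d → ℝ)} (hV : IsOpen V) (hne : V.Nonempty) (h : EqOn g g' V) : g = g' := by
  obtain ⟨A, rfl⟩ := hg.exists_affineMap
  obtain ⟨B, rfl⟩ := hg'.exists_affineMap
  rw [AffineMap.ext_on (hV.affineSpan_eq_top hne) h]

lemma IsAffineFn.comp_init {g : (Fin d → ℝ) → ℝ} (hg : IsAffineFn g) :
    IsAffineFn (fun w : Fin (d + 1) → ℝ => g (Fin.init w)) := by
  obtain ⟨a, b, h⟩ := hg
  refine ⟨Fin.snoc (α := fun _ => ℝ) a 0, b, fun w => ?_⟩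
  simp [h, Fin.sum_univ_castSucc, Fin.init]

lemma isAffineFn_last (a b : ℝ) :
    IsAffineFn (fun w : Fin (d + 1) → ℝ => a * w (Fin.last d) + b) := by
  refine ⟨Fin.snoc (α := fun _ => ℝ) 0 a, b, fun w => ?_⟩
  simp [Fin.sum_univ_castSucc]

end Affine

section MaximalPiece

variable {d : ℕ} {f : (Fin d → ℝ) → ℝ}

lemma IsMaximalPiece.eq_of_subset {P V : Set (Fin d → ℝ)} (hP : IsMaximalPiece f P)
    (hPV : P ⊆ V) (hV : IsOpen V) (hVc : IsConnected V) (hVf : AffineOnSet f V) : V = P := by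
  by_contra hne
  refine hP.2.2.2 ⟨V \ P, ?_, fun x hx => hx.2, ?_⟩
  · rw [nonempty_iff_ne_empty, Ne, sdiff_eq_empty]
    exact fun h => hne (h.antisymm hPV)
  · rw [union_sdiff_cancel hPV]
    exact ⟨hV, hVc, hVf⟩

/-- Every piece is contained in a maximal one. -/
lemma exists_isMaximalPiece_superset {Q : Set (Fin d → ℝ)} (hQ : IsOpen Q) (hQc : IsConnected Q)
    (hQf : AffineOnSet f Q) : ∃ M, IsMaximalPiece f M ∧ Q ⊆ M := by
  obtain ⟨g, hg, hgQ⟩ := hQf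
  set S : Set (Set (Fin d → ℝ)) :=
    {V | Q ⊆ V ∧ IsOpen V ∧ IsConnected V ∧ AffineOnSet f V} with hS
  have hQM : Q ⊆ ⋃₀ S := subset_sUnion_of_mem ⟨subset_rfl, hQ, hQc, g, hg, hgQ⟩
  obtain ⟨q, hq⟩ := hQc.nonempty
  refine ⟨⋃₀ S, ⟨isOpen_sUnion fun V hV => hV.2.1, ⟨⟨q, hQM hq⟩, ?_⟩, ⟨g, hg, ?_⟩, ?_⟩, hQM⟩
  · exact isPreconnected_sUnion q S (fun V hV => hV.1 hq) fun V hV => hV.2.2.1.isPreconnected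
  · rintro x ⟨V, ⟨hQV, -, -, g', hg', hgV⟩, hx⟩
    rw [hgV x hx, hg.eq_of_eqOn hg' hQ ⟨q, hq⟩ fun y hy => by rw [← hgQ y hy, hgV y (hQV hy)]]
  · rintro ⟨U, ⟨u, hu⟩, hUM, hUo, hUc, hUf⟩
    exact hUM hu (mem_sUnion_of_mem (mem_union_right _ hu)
      ⟨hQM.trans subset_union_left, hUo, hUc, hUf⟩)

end MaximalPiece

section Slices

variable {d : ℕ}

lemma continuous_init : Continuous (Fin.init : (Fin (d + 1) → ℝ) → Fin d → ℝ) :=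
  continuous_pi fun i => continuous_apply i.castSucc

lemma continuous_snoc_left (t : ℝ) :
    Continuous (fun x : Fin d → ℝ => Fin.snoc (α := fun _ => ℝ) x t) :=
  Continuous.finSnoc continuous_id continuous_const

lemma continuous_snoc_right (x : Fin d → ℝ) :
    Continuous (fun t : ℝ => Fin.snoc (α := fun _ => ℝ) x t) :=
  Continuous.finSnoc continuous_const continuous_id

lemma isOpenMap_init : IsOpenMap (Fin.init : (Fin (d + 1) → ℝ) → Fin d → ℝ) :=
  IsOpenMap.of_sections fun w => ⟨fun x => Fin.snoc (α := fun _ => ℝ) x (w (Fin.last d)),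
    (continuous_snoc_left _).continuousAt, Fin.snoc_init_self w, fun x => Fin.init_snoc (α := fun _ => ℝ) _ x⟩

/-- A set whose vertical slices are intervals over a connected base, with a continuous section,
is connected. -/
lemma isConnected_of_slices {P : Set (Fin d → ℝ)} (hP : IsConnected P)
    {W : Set (Fin (d + 1) → ℝ)} {σ : (Fin d → ℝ) → ℝ} (hσ : Continuous σ)
    (hW : ∀ w ∈ W, Fin.init w ∈ P) (hmem : ∀ x ∈ P, Fin.snoc (α := fun _ => ℝ) x (σ x) ∈ W)
    (hord : ∀ x ∈ P, OrdConnected {t : ℝ | Fin.snoc (α := fun _ => ℝ) x t ∈ W}) :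
    IsConnected W := by
  have hgraph : IsPreconnected ((fun x => Fin.snoc (α := fun _ => ℝ) x (σ x)) '' P) :=
    hP.isPreconnected.image _ (Continuous.finSnoc (A := fun _ => ℝ) continuous_id hσ).continuousOn
  obtain ⟨x₀, hx₀⟩ := hP.nonempty
  refine ⟨⟨_, hmem x₀ hx₀⟩, isPreconnected_of_forall (Fin.snoc (α := fun _ => ℝ) x₀ (σ x₀)) fun w hw => ?_⟩
  have hx := hW w hw
  have hw' : Fin.snoc (α := fun _ => ℝ) (Fin.init w) (w (Fin.last d)) ∈ W := by
    rwa [Fin.snoc_init_self]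
  refine ⟨(fun x => Fin.snoc (α := fun _ => ℝ) x (σ x)) '' P ∪
    (fun t => Fin.snoc (α := fun _ => ℝ) (Fin.init w) t) '' uIcc (σ (Fin.init w))
      (w (Fin.last d)), ?_, Or.inl ⟨x₀, hx₀, rfl⟩, Or.inr ⟨_, right_mem_uIcc, ?_⟩, ?_⟩
  · rintro _ (⟨x, hxP, rfl⟩ | ⟨t, ht, rfl⟩)
    · exact hmem x hxP
    · exact (hord _ hx).uIcc_subset (hmem _ hx) hw' ht
  · exact Fin.snoc_init_self w
  · exact hgraph.union _ ⟨_, hx, rfl⟩ ⟨_, left_mem_uIcc, rfl⟩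
      (isPreconnected_uIcc.image _ (continuous_snoc_right _).continuousOn)

end Slices

/-- The tooth of height `zmax` with apex at `2 * k + 1`, extended linearly. -/
noncomputable def tent (zmin zmax : ℝ) (k : ℕ) (t : ℝ) : ℝ :=
  zmin + (zmax - zmin) * (1 - |t - (2 * k + 1)|)

section Sawtooth

variable {zmin zmax : ℝ} {m k : ℕ} {t : ℝ}

lemma continuous_tent : Continuous (tent zmin zmax k) := by
  unfold tent
  fun_prop

lemma tent_le_tent {j k : ℕ} {t t' : ℝ} (hz : zmin ≤ zmax)
    (h : |t - (2 * k + 1)| ≤ |t' - (2 * j + 1)|) : tent zmin zmax j t' ≤ tent zmin zmax k t := by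
  have := mul_le_mul_of_nonneg_left h (sub_nonneg.2 hz)
  unfold tent
  linarith

lemma tent_lt_tent {j k : ℕ} {t t' : ℝ} (hz : zmin < zmax)
    (h : |t - (2 * k + 1)| < |t' - (2 * j + 1)|) : tent zmin zmax j t' < tent zmin zmax k t := by
  have := mul_lt_mul_of_pos_left h (sub_pos.2 hz)
  unfold tent
  linarith

lemma tent_strictMonoOn (hz : zmin < zmax) :
    StrictMonoOn (tent zmin zmax k) (Iic (2 * k + 1)) := fun a ha b hb hab => by
  rw [mem_Iic] at ha hb
  apply tent_lt_tent hz
  rw [abs_of_nonpos (by linarith), abs_of_nonpos (by linarith)]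
  linarith

lemma tent_strictAntiOn (hz : zmin < zmax) :
    StrictAntiOn (tent zmin zmax k) (Ici (2 * k + 1)) := fun a ha b hb hab => by
  rw [mem_Ici] at ha hb
  apply tent_lt_tent hz
  rw [abs_of_nonneg (by linarith), abs_of_nonneg (by linarith)]
  linarith

lemma tent_apex : tent zmin zmax k (2 * k + 1) = zmax := by
  simp [tent]

lemma ordConnected_lt_tent (hz : zmin ≤ zmax) (c : ℝ) :
    OrdConnected {t | c < tent zmin zmax k t} := by
  refine ⟨fun a ha b hb t ht => ?_⟩
  have := abs_le_max_abs_abs (sub_le_sub_right ht.1 (2 * k + 1 : ℝ))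
    (sub_le_sub_right ht.2 (2 * k + 1 : ℝ))
  rcases le_max_iff.1 this with h | h
  · exact lt_of_lt_of_le ha (tent_le_tent hz h)
  · exact lt_of_lt_of_le hb (tent_le_tent hz h)

lemma sawtooth_eq_tent (hk : k < m) (hl : k = 0 ∨ 2 * k ≤ t) (hr : k + 1 = m ∨ t ≤ 2 * k + 2) :
    sawtooth m zmin zmax t = tent zmin zmax k t := by
  have hkm : (k : ℝ) + 1 ≤ m := by exact_mod_cast hk
  have hk0 : (0 : ℝ) ≤ k := k.cast_nonneg
  unfold sawtooth tent
  split_ifs with h0 h1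
  · have : (k : ℝ) = 0 := by
      rcases hl with rfl | hl
      · simp
      · linarith
    rw [this, abs_of_nonpos (by linarith)]
    ring
  · have : (k : ℝ) + 1 = m := by
      rcases hr with rfl | hr
      · simp
      · linarith
    rw [abs_of_nonneg (by linarith), ← this]
    ring
  · push Not at h0 h1
    have hl' : 2 * (k : ℝ) ≤ t := by
      rcases hl with rfl | hl
      · simpa using h0.le
      · exact hl
    have hr' : t ≤ 2 * k + 2 := by
      rcases hr with rfl | hr
      · push_cast at h1; linarith
      · exact hr
    rcases hr'.lt_or_eq with hr' | rfl
    · have : ⌊t / 2⌋ = (k : ℤ) := by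
        rw [Int.floor_eq_iff]
        push_cast
        constructor <;> linarith
      rw [this]
      push_cast
      ring_nf
    · have : ⌊(2 * k + 2 : ℝ) / 2⌋ = (k : ℤ) + 1 := by
        rw [Int.floor_eq_iff]
        push_cast
        constructor <;> linarith
      rw [this]
      push_cast
      ring_nf
      norm_num

lemma exists_tooth (hm : 1 ≤ m) (t : ℝ) :
    ∃ k < m, (k = 0 ∨ 2 * (k : ℝ) ≤ t) ∧ (k + 1 = m ∨ t ≤ 2 * k + 2) := by
  induction m, hm using Nat.le_induction with
  | base => exact ⟨0, one_pos, Or.inl rfl, Or.inl rfl⟩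
  | succ n hn ih =>
    rcases le_total t (2 * n) with h | h
    · obtain ⟨k, hk, hl, hr⟩ := ih
      refine ⟨k, hk.trans n.lt_succ_self, hl, Or.inr ?_⟩
      rcases hr with rfl | hr
      · push_cast at h; linarith
      · exact hr
    · exact ⟨n, n.lt_succ_self, Or.inr h, Or.inl rfl⟩

lemma tent_le_sawtooth (hz : zmin ≤ zmax) (hk : k < m) :
    tent zmin zmax k t ≤ sawtooth m zmin zmax t := by
  obtain ⟨j, hj, hl, hr⟩ := exists_tooth (by omega : 1 ≤ m) t
  rw [sawtooth_eq_tent hj hl hr]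
  apply tent_le_tent hz
  rcases lt_trichotomy k j with h | rfl | h
  · have h' : (k : ℝ) + 1 ≤ j := by exact_mod_cast h
    have hl' : 2 * (j : ℝ) ≤ t := hl.resolve_left (by omega)
    rw [abs_of_nonneg (by linarith : 0 ≤ t - (2 * k + 1)), abs_le]
    constructor <;> linarith
  · rfl
  · have h' : (j : ℝ) + 1 ≤ k := by exact_mod_cast h
    have hr' : t ≤ 2 * j + 2 := hr.resolve_left (by omega)
    rw [abs_of_nonpos (by linarith : t - (2 * k + 1) ≤ 0), abs_le]
    constructor <;> linarith

lemma continuous_sawtooth (hm : 1 ≤ m) (hz : zmin ≤ zmax) :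
    Continuous (sawtooth m zmin zmax) := by
  have hne : (Finset.range m).Nonempty := Finset.nonempty_range_iff.2 (by omega)
  have : sawtooth m zmin zmax = (Finset.range m).sup' hne (tent zmin zmax) := by
    funext t
    rw [Finset.sup'_apply]
    apply le_antisymm
    · obtain ⟨k, hk, hl, hr⟩ := exists_tooth hm t
      rw [sawtooth_eq_tent hk hl hr]
      exact Finset.le_sup' (fun k => tent zmin zmax k t) (Finset.mem_range.2 hk)
    · exact Finset.sup'_le _ _ fun k hk => tent_le_sawtooth hz (Finset.mem_range.1 hk)
  rw [this]
  exact Continuous.finset_sup' hne fun k _ => continuous_tent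

/-- The sides of the teeth. -/
lemma exists_side (hm : 1 ≤ m) (ht : sawtooth m zmin zmax t < zmax) :
    ∃ k < m, ((k = 0 ∨ 2 * (k : ℝ) ≤ t) ∧ t < 2 * k + 1) ∨
      (2 * (k : ℝ) + 1 < t ∧ (k + 1 = m ∨ t ≤ 2 * k + 2)) := by
  obtain ⟨k, hk, hl, hr⟩ := exists_tooth hm t
  refine ⟨k, hk, ?_⟩
  rcases lt_trichotomy t (2 * k + 1) with h | h | h
  · exact Or.inl ⟨hl, h⟩
  · rw [sawtooth_eq_tent hk hl hr, h, tent_apex] at ht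
    exact absurd ht (lt_irrefl _)
  · exact Or.inr ⟨h, hr⟩

lemma sawtooth_eq_tent_left (hk : k < m) (hl : k = 0 ∨ 2 * k ≤ t) (hr : t ≤ 2 * k + 1) :
    sawtooth m zmin zmax t = tent zmin zmax k t :=
  sawtooth_eq_tent hk hl (Or.inr (by linarith))

lemma sawtooth_eq_tent_right (hk : k < m) (hl : 2 * k + 1 ≤ t) (hr : k + 1 = m ∨ t ≤ 2 * k + 2) :
    sawtooth m zmin zmax t = tent zmin zmax k t :=
  sawtooth_eq_tent hk (Or.inr (by linarith)) hr

lemma not_eventually_sawtooth_eq (hm : 1 ≤ m) (hz : zmin < zmax)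
    (ht : sawtooth m zmin zmax t < zmax) :
    ¬ ∀ᶠ u in 𝓝 t, sawtooth m zmin zmax u = sawtooth m zmin zmax t := by
  intro hev
  obtain ⟨k, hk, ⟨hl, hr⟩ | ⟨hl, hr⟩⟩ := exists_side hm ht
  · obtain ⟨u, hu, htu, huk⟩ := ((hev.filter_mono nhdsWithin_le_nhds).and
      (Ioo_mem_nhdsGT hr)).exists
    rw [sawtooth_eq_tent_left hk (hl.imp_right fun h => h.trans htu.le) huk.le,
      sawtooth_eq_tent_left hk hl hr.le] at hu
    exact (tent_strictMonoOn hz (mem_Iic.2 hr.le) (mem_Iic.2 huk.le) htu).ne' hu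
  · obtain ⟨u, hu, huk, htu⟩ := ((hev.filter_mono nhdsWithin_le_nhds).and
      (Ioo_mem_nhdsLT hl)).exists
    rw [sawtooth_eq_tent_right hk huk.le (hr.imp_right fun h => htu.le.trans h),
      sawtooth_eq_tent_right hk hl.le hr] at hu
    exact (tent_strictAntiOn hz (mem_Ici.2 huk.le) (mem_Ici.2 hl.le) htu).ne' hu

end Sawtooth

section Pieces

variable {d m k : ℕ} {f : (Fin d → ℝ) → ℝ} {zmin zmax : ℝ}

/-- The part of a tooth that lies above the graph of `f` over `P`. -/
def topPiece (f : (Fin d → ℝ) → ℝ) (zmin zmax : ℝ) (P : Set (Fin d → ℝ)) (k : ℕ) :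
    Set (Fin (d + 1) → ℝ) :=
  {w | Fin.init w ∈ P ∧ f (Fin.init w) < tent zmin zmax k (w (Fin.last d))}

/-- The part of the left side of a tooth that lies below the graph of `f`. -/
def leftPiece (f : (Fin d → ℝ) → ℝ) (zmin zmax : ℝ) (k : ℕ) : Set (Fin (d + 1) → ℝ) :=
  {w | (k = 0 ∨ 2 * (k : ℝ) < w (Fin.last d)) ∧ w (Fin.last d) < 2 * k + 1 ∧
    tent zmin zmax k (w (Fin.last d)) < f (Fin.init w)}

/-- The part of the right side of a tooth that lies below the graph of `f`. -/
def rightPiece (f : (Fin d → ℝ) → ℝ) (zmin zmax : ℝ) (m k : ℕ) : Set (Fin (d + 1) → ℝ) :=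
  {w | 2 * (k : ℝ) + 1 < w (Fin.last d) ∧ (k + 1 = m ∨ w (Fin.last d) < 2 * k + 2) ∧
    tent zmin zmax k (w (Fin.last d)) < f (Fin.init w)}

lemma continuous_comp_init (hf : Continuous f) :
    Continuous (fun w : Fin (d + 1) → ℝ => f (Fin.init w)) := hf.comp continuous_init

lemma continuous_tent_last :
    Continuous (fun w : Fin (d + 1) → ℝ => tent zmin zmax k (w (Fin.last d))) :=
  continuous_tent.comp (continuous_apply _)

lemma isOpen_topPiece (hf : Continuous f) {P : Set (Fin d → ℝ)} (hP : IsOpen P) :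
    IsOpen (topPiece f zmin zmax P k) :=
  (hP.preimage continuous_init).inter
    (isOpen_lt (continuous_comp_init hf) continuous_tent_last)

lemma isOpen_leftPiece (hf : Continuous f) : IsOpen (leftPiece f zmin zmax k) :=
  (isOpen_const.union (isOpen_lt continuous_const (continuous_apply _))).inter
    ((isOpen_lt (continuous_apply _) continuous_const).inter
      (isOpen_lt continuous_tent_last (continuous_comp_init hf)))

lemma isOpen_rightPiece (hf : Continuous f) : IsOpen (rightPiece f zmin zmax m k) :=
  (isOpen_lt continuous_const (continuous_apply _)).inter
    ((isOpen_const.union (isOpen_lt (continuous_apply _) continuous_const)).inter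
      (isOpen_lt continuous_tent_last (continuous_comp_init hf)))

lemma isConnected_topPiece (hz : zmin ≤ zmax) (hlt : ∀ x, f x < zmax)
    {P : Set (Fin d → ℝ)} (hP : IsConnected P) : IsConnected (topPiece f zmin zmax P k) := by
  refine isConnected_of_slices hP (σ := fun _ => 2 * k + 1) continuous_const
    (fun w hw => hw.1) (fun x hx => ?_) fun x hx => ?_
  · simpa [topPiece, tent_apex, hx] using hlt x
  · simpa [topPiece, hx] using ordConnected_lt_tent hz (f x)

/-- The relative height of `f x` between `zmin` and `zmax`, halved. -/
lemma half_height (hgt : ∀ x, zmin < f x) (hlt : ∀ x, f x < zmax) (x : Fin d → ℝ) :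
    0 < (f x - zmin) / (2 * (zmax - zmin)) ∧ (f x - zmin) / (2 * (zmax - zmin)) < 1 ∧
      zmin + (zmax - zmin) * ((f x - zmin) / (2 * (zmax - zmin))) < f x := by
  have h1 := hgt x
  have h2 := hlt x
  have h3 : 0 < zmax - zmin := by linarith
  refine ⟨div_pos (by linarith) (by linarith), ?_, ?_⟩
  · rw [div_lt_one (by linarith)]
    linarith
  · have : (zmax - zmin) * ((f x - zmin) / (2 * (zmax - zmin))) = (f x - zmin) / 2 := by
      field_simp
    linarith

lemma isConnected_leftPiece (hf : Continuous f) (hgt : ∀ x, zmin < f x)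
    (hlt : ∀ x, f x < zmax) : IsConnected (leftPiece f zmin zmax k) := by
  have hz : zmin < zmax := (hgt 0).trans (hlt 0)
  refine isConnected_of_slices isConnected_univ
    (σ := fun x => 2 * k + (f x - zmin) / (2 * (zmax - zmin))) (by fun_prop)
    (fun w _ => mem_univ _) (fun x _ => ?_) fun x _ => ⟨fun a ha b hb t ht => ?_⟩
  · obtain ⟨h0, h1, h2⟩ := half_height hgt hlt x
    set u := (f x - zmin) / (2 * (zmax - zmin))
    simp only [leftPiece, mem_ofPred_eq, Fin.snoc_last, Fin.init_snoc]
    refine ⟨Or.inr (by linarith), by linarith, ?_⟩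
    rw [tent, abs_of_nonpos (by linarith)]
    linarith
  · simp only [leftPiece, mem_ofPred_eq, Fin.snoc_last, Fin.init_snoc] at ha hb ⊢
    have htk : t < 2 * k + 1 := ht.2.trans_lt hb.2.1
    exact ⟨ha.1.imp_right fun h => h.trans_le ht.1, htk,
      ((tent_strictMonoOn hz).monotoneOn (mem_Iic.2 htk.le) (mem_Iic.2 hb.2.1.le)
        ht.2).trans_lt hb.2.2⟩

lemma isConnected_rightPiece (hf : Continuous f) (hgt : ∀ x, zmin < f x)
    (hlt : ∀ x, f x < zmax) : IsConnected (rightPiece f zmin zmax m k) := by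
  have hz : zmin < zmax := (hgt 0).trans (hlt 0)
  refine isConnected_of_slices isConnected_univ
    (σ := fun x => 2 * k + 2 - (f x - zmin) / (2 * (zmax - zmin))) (by fun_prop)
    (fun w _ => mem_univ _) (fun x _ => ?_) fun x _ => ⟨fun a ha b hb t ht => ?_⟩
  · obtain ⟨h0, h1, h2⟩ := half_height hgt hlt x
    set u := (f x - zmin) / (2 * (zmax - zmin))
    simp only [rightPiece, mem_ofPred_eq, Fin.snoc_last, Fin.init_snoc]
    refine ⟨by linarith, Or.inr (by linarith), ?_⟩
    rw [tent, abs_of_nonneg (by linarith)]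
    linarith
  · simp only [rightPiece, mem_ofPred_eq, Fin.snoc_last, Fin.init_snoc] at ha hb ⊢
    have htk : 2 * k + 1 < t := ha.1.trans_le ht.1
    exact ⟨htk, hb.2.1.imp_right fun h => ht.2.trans_lt h,
      ((tent_strictAntiOn hz).antitoneOn (mem_Ici.2 ha.1.le) (mem_Ici.2 htk.le)
        ht.1).trans_lt ha.2.2⟩

/-- The minimum of `f` and the sawtooth in a new last coordinate. -/
noncomputable def minSawtooth (f : (Fin d → ℝ) → ℝ) (m : ℕ) (zmin zmax : ℝ)
    (w : Fin (d + 1) → ℝ) : ℝ :=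
  min (f (Fin.init w)) (sawtooth m zmin zmax (w (Fin.last d)))

lemma minSawtooth_topPiece (hz : zmin ≤ zmax) (hk : k < m) {P : Set (Fin d → ℝ)}
    {w : Fin (d + 1) → ℝ} (hw : w ∈ topPiece f zmin zmax P k) :
    minSawtooth f m zmin zmax w = f (Fin.init w) :=
  min_eq_left (hw.2.le.trans (tent_le_sawtooth hz hk))

lemma affineOnSet_topPiece (hz : zmin ≤ zmax) (hk : k < m) {P : Set (Fin d → ℝ)}
    (hP : AffineOnSet f P) :
    AffineOnSet (minSawtooth f m zmin zmax) (topPiece f zmin zmax P k) := by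
  obtain ⟨g, hg, hgP⟩ := hP
  exact ⟨_, hg.comp_init, fun w hw => by rw [minSawtooth_topPiece hz hk hw, hgP _ hw.1]⟩

lemma affineOnSet_leftPiece (hk : k < m) :
    AffineOnSet (minSawtooth f m zmin zmax) (leftPiece f zmin zmax k) := by
  refine ⟨_, isAffineFn_last (zmax - zmin) (zmin - (zmax - zmin) * (2 * k)),
    fun w ⟨hl, hr, hlt⟩ => ?_⟩
  rw [minSawtooth, sawtooth_eq_tent_left hk (hl.imp_right le_of_lt) hr.le, min_eq_right hlt.le,
    tent, abs_of_nonpos (by linarith)]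
  ring

lemma affineOnSet_rightPiece (hk : k < m) :
    AffineOnSet (minSawtooth f m zmin zmax) (rightPiece f zmin zmax m k) := by
  refine ⟨_, isAffineFn_last (-(zmax - zmin)) (zmin + (zmax - zmin) * (2 * k + 2)),
    fun w ⟨hl, hr, hlt⟩ => ?_⟩
  rw [minSawtooth, sawtooth_eq_tent_right hk hl.le (hr.imp_right le_of_lt), min_eq_right hlt.le,
    tent, abs_of_nonneg (by linarith)]
  ring

lemma continuous_minSawtooth (hm : 1 ≤ m) (hz : zmin ≤ zmax) (hf : Continuous f) :
    Continuous (minSawtooth f m zmin zmax) :=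
  (continuous_comp_init hf).min ((continuous_sawtooth hm hz).comp (continuous_apply _))

lemma mem_closure_of_frequently_snoc {W : Set (Fin (d + 1) → ℝ)} {w : Fin (d + 1) → ℝ}
    (h : ∃ᶠ t in 𝓝 (w (Fin.last d)), Fin.snoc (α := fun _ => ℝ) (Fin.init w) t ∈ W) :
    w ∈ closure W := by
  refine mem_closure_of_frequently_of_tendsto h ?_
  have := (continuous_snoc_right (Fin.init w)).tendsto (w (Fin.last d))
  rwa [Fin.snoc_init_self] at this

lemma mem_closure_piece (hm : 1 ≤ m) (hgt : ∀ x, zmin < f x) (hlt : ∀ x, f x < zmax)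
    {P : Set (Fin d → ℝ)} {w : Fin (d + 1) → ℝ} (hw : Fin.init w ∈ P) :
    ∃ k < m, w ∈ closure (topPiece f zmin zmax P k) ∨ w ∈ closure (leftPiece f zmin zmax k) ∨
      w ∈ closure (rightPiece f zmin zmax m k) := by
  have hz : zmin < zmax := (hgt 0).trans (hlt 0)
  set x := Fin.init w with hx
  set t := w (Fin.last d) with ht
  rcases lt_or_ge (f x) (sawtooth m zmin zmax t) with h | h
  · obtain ⟨k, hk, hl, hr⟩ := exists_tooth hm t
    rw [sawtooth_eq_tent hk hl hr] at h
    exact ⟨k, hk, Or.inl (subset_closure ⟨hw, h⟩)⟩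
  obtain ⟨k, hk, ⟨hl, hr⟩ | ⟨hl, hr⟩⟩ := exists_side hm (h.trans_lt (hlt x)) <;>
    refine ⟨k, hk, ?_⟩
  · rw [sawtooth_eq_tent_left hk hl hr.le] at h
    rcases h.lt_or_eq with h | h
    · refine Or.inr (Or.inl (mem_closure_of_frequently_snoc ?_))
      refine Frequently.filter_mono (f := 𝓝[>] t) (Eventually.frequently ?_) nhdsWithin_le_nhds
      filter_upwards [Ioo_mem_nhdsGT hr,
        nhdsWithin_le_nhds (continuous_tent.continuousAt.eventually_lt_const h)] with u hu hu'
      simp only [leftPiece, mem_ofPred_eq, Fin.snoc_last, Fin.init_snoc]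
      exact ⟨hl.imp_right fun h => h.trans_lt hu.1, hu.2, hu'⟩
    · refine Or.inl (mem_closure_of_frequently_snoc ?_)
      refine Frequently.filter_mono (f := 𝓝[>] t) (Eventually.frequently ?_) nhdsWithin_le_nhds
      filter_upwards [Ioo_mem_nhdsGT hr] with u hu
      simp only [topPiece, mem_ofPred_eq, Fin.snoc_last, Fin.init_snoc]
      exact ⟨hw, h ▸ tent_strictMonoOn hz (mem_Iic.2 hr.le) (mem_Iic.2 hu.2.le) hu.1⟩
  · rw [sawtooth_eq_tent_right hk hl.le hr] at h
    rcases h.lt_or_eq with h | h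
    · refine Or.inr (Or.inr (mem_closure_of_frequently_snoc ?_))
      refine Frequently.filter_mono (f := 𝓝[<] t) (Eventually.frequently ?_) nhdsWithin_le_nhds
      filter_upwards [Ioo_mem_nhdsLT hl,
        nhdsWithin_le_nhds (continuous_tent.continuousAt.eventually_lt_const h)] with u hu hu'
      simp only [rightPiece, mem_ofPred_eq, Fin.snoc_last, Fin.init_snoc]
      exact ⟨hu.1, hr.imp_right fun h => hu.2.trans_le h, hu'⟩
    · refine Or.inl (mem_closure_of_frequently_snoc ?_)
      refine Frequently.filter_mono (f := 𝓝[<] t) (Eventually.frequently ?_) nhdsWithin_le_nhds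
      filter_upwards [Ioo_mem_nhdsLT hl] with u hu
      simp only [topPiece, mem_ofPred_eq, Fin.snoc_last, Fin.init_snoc]
      exact ⟨hw, h ▸ tent_strictAntiOn hz (mem_Ici.2 hu.1.le) (mem_Ici.2 hl.le) hu.2⟩

open Classical in
lemma isCPA_minSawtooth (hf : IsCPA f) (hm : 1 ≤ m) (hgt : ∀ x, zmin < f x)
    (hlt : ∀ x, f x < zmax) : IsCPA (minSawtooth f m zmin zmax) := by
  obtain ⟨hfc, Ps, hPs, hcov⟩ := hf
  have hz : zmin < zmax := (hgt 0).trans (hlt 0)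
  refine ⟨continuous_minSawtooth hm hz.le hfc,
    (Ps ×ˢ Finset.range m).image (fun a => topPiece f zmin zmax a.1 a.2) ∪
      ((Finset.range m).image (leftPiece f zmin zmax) ∪
        (Finset.range m).image (rightPiece f zmin zmax m)), fun Q hQ => ?_, ?_⟩
  · simp only [Finset.mem_union, Finset.mem_image, Finset.mem_product, Finset.mem_range,
      Prod.exists] at hQ
    rcases hQ with ⟨P, k, ⟨hP, hk⟩, rfl⟩ | ⟨k, hk, rfl⟩ | ⟨k, hk, rfl⟩
    · obtain ⟨hPo, hPc, hPf⟩ := hPs P hP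
      exact ⟨isOpen_topPiece hfc hPo, isConnected_topPiece hz.le hlt hPc,
        affineOnSet_topPiece hz.le hk hPf⟩
    · exact ⟨isOpen_leftPiece hfc, isConnected_leftPiece hfc hgt hlt, affineOnSet_leftPiece hk⟩
    · exact ⟨isOpen_rightPiece hfc, isConnected_rightPiece hfc hgt hlt,
        affineOnSet_rightPiece hk⟩
  · have hdense : Dense (⋃ P ∈ Ps, P) := by
      rw [dense_iff_closure_eq, Finset.closure_biUnion, hcov]
    rw [← Finset.closure_biUnion, ← dense_iff_closure_eq, ← dense_closure]
    refine (hdense.preimage isOpenMap_init).mono fun w hw => ?_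
    simp only [mem_preimage, mem_iUnion] at hw
    obtain ⟨P, hP, hw⟩ := hw
    obtain ⟨k, hk, h⟩ := mem_closure_piece hm hgt hlt hw
    rcases h with h | h | h <;> refine closure_mono (subset_biUnion_of_mem (u := id) ?_) h <;>
      simp only [Finset.coe_union, Finset.coe_image, Finset.coe_product, Finset.coe_range,
        mem_union, mem_image, Finset.mem_coe, mem_prod, Prod.exists, mem_Iio]
    · exact Or.inl ⟨P, k, ⟨hP, hk⟩, rfl⟩
    · exact Or.inr (Or.inl ⟨k, hk, rfl⟩)
    · exact Or.inr (Or.inr ⟨k, hk, rfl⟩)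

/-- On an open set where `minSawtooth` does not depend on the last coordinate, `f` lies below
the sawtooth. -/
lemma le_sawtooth_of_eqOn (hm : 1 ≤ m) (hlt : ∀ x, f x < zmax) (hz : zmin < zmax)
    {M : Set (Fin (d + 1) → ℝ)} (hM : IsOpen M) {g : (Fin d → ℝ) → ℝ}
    (hg : ∀ w ∈ M, minSawtooth f m zmin zmax w = g (Fin.init w))
    {w : Fin (d + 1) → ℝ} (hw : w ∈ M) :
    f (Fin.init w) ≤ sawtooth m zmin zmax (w (Fin.last d)) := by
  by_contra! h
  refine not_eventually_sawtooth_eq hm hz (h.trans (hlt _)) ?_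
  have hmem : ∀ᶠ t in 𝓝 (w (Fin.last d)),
      Fin.snoc (α := fun _ => ℝ) (Fin.init w) t ∈ M := by
    refine (continuous_snoc_right (Fin.init w)).continuousAt.eventually_mem (hM.mem_nhds ?_)
    rwa [Fin.snoc_init_self]
  filter_upwards [hmem, (continuous_sawtooth hm hz.le).continuousAt.eventually_lt_const h]
    with t ht ht'
  have h1 := hg _ ht
  have h2 := hg _ hw
  simp only [minSawtooth, Fin.init_snoc, Fin.snoc_last] at h1 h2
  rw [min_eq_right ht'.le] at h1
  rw [min_eq_right h.le] at h2
  rw [h1, h2]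

lemma sawtooth_two_mul_le {j : ℕ} (hj : j ≤ m) :
    sawtooth m zmin zmax (2 * j) ≤ zmin := by
  rcases Nat.eq_zero_or_pos m with rfl | hm
  · obtain rfl : j = 0 := by omega
    simp [sawtooth]
  rcases hj.lt_or_eq with hj | rfl
  · rw [sawtooth_eq_tent hj (Or.inr le_rfl) (Or.inr (by linarith)), tent]
    norm_num
  · obtain ⟨k, rfl⟩ : ∃ k, j = k + 1 := ⟨j - 1, by omega⟩
    rw [sawtooth_eq_tent k.lt_succ_self (Or.inr (by push_cast; linarith)) (Or.inl rfl), tent]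
    push_cast
    ring_nf
    norm_num

/-- The apex points of two different teeth do not lie in a common connected set on which
`f` is below the sawtooth. -/
lemma tooth_le_of_isPreconnected (hgt : ∀ x, zmin < f x)
    {M : Set (Fin (d + 1) → ℝ)} (hM : IsPreconnected M)
    (hle : ∀ w ∈ M, f (Fin.init w) ≤ sawtooth m zmin zmax (w (Fin.last d)))
    {k j : ℕ} (hk : k < m) {v w : Fin (d + 1) → ℝ} (hv : v ∈ M) (hw : w ∈ M)
    (hvk : v (Fin.last d) = 2 * k + 1) (hwj : w (Fin.last d) = 2 * j + 1) : j ≤ k := by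
  by_contra! h
  have h' : (k : ℝ) + 1 ≤ j := by exact_mod_cast h
  obtain ⟨u, hu, hut⟩ := hM.intermediate_value hv hw
    (continuous_apply (Fin.last d)).continuousOn
    (show (2 * ((k + 1 : ℕ) : ℝ)) ∈ Icc _ _ by
      push_cast
      constructor <;> linarith)
  have h1 := hle u hu
  rw [show u (Fin.last d) = _ from hut] at h1
  exact absurd (h1.trans (sawtooth_two_mul_le hk)) (hgt _).not_ge

lemma exists_isMaximalPiece_topPiece (hf : Continuous f) (hlt : ∀ x, f x < zmax)
    (hz : zmin ≤ zmax) (hk : k < m) {P : Set (Fin d → ℝ)} (hP : IsMaximalPiece f P) :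
    ∃ M, IsMaximalPiece (minSawtooth f m zmin zmax) M ∧ topPiece f zmin zmax P k ⊆ M :=
  exists_isMaximalPiece_superset (isOpen_topPiece hf hP.1) (isConnected_topPiece hz hlt hP.2.1)
    (affineOnSet_topPiece hz hk hP.2.2.1)

lemma snoc_apex_mem_topPiece (hlt : ∀ x, f x < zmax) {P : Set (Fin d → ℝ)} {x : Fin d → ℝ}
    (hx : x ∈ P) :
    Fin.snoc (α := fun _ => ℝ) x (2 * (k : ℝ) + 1) ∈ topPiece f zmin zmax P k := by
  simpa [topPiece, tent_apex, hx] using hlt x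

/-- A maximal piece of `minSawtooth` that contains the top piece over `P` lies where `f` is
below the sawtooth, and projects onto `P`. -/
lemma IsMaximalPiece.of_topPiece_subset (hf : Continuous f) (hm : 1 ≤ m)
    (hlt : ∀ x, f x < zmax) (hz : zmin < zmax) (hk : k < m)
    {P : Set (Fin d → ℝ)} (hP : IsMaximalPiece f P) {M : Set (Fin (d + 1) → ℝ)}
    (hM : IsMaximalPiece (minSawtooth f m zmin zmax) M) (hPM : topPiece f zmin zmax P k ⊆ M) :
    (∀ w ∈ M, f (Fin.init w) ≤ sawtooth m zmin zmax (w (Fin.last d))) ∧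
      Fin.init '' M = P := by
  obtain ⟨hMo, hMc, ⟨G, hG, hGM⟩, -⟩ := hM
  obtain ⟨g, hg, hgP⟩ := hP.2.2.1
  have hGg : G = fun w => g (Fin.init w) :=
    hG.eq_of_eqOn hg.comp_init (isOpen_topPiece hf hP.1)
      (isConnected_topPiece (k := k) hz.le hlt hP.2.1).nonempty fun w hw => by
        rw [← hGM w (hPM hw), minSawtooth_topPiece hz.le hk hw, hgP _ hw.1]
  subst hGg
  have hle := fun w (hw : w ∈ M) => le_sawtooth_of_eqOn hm hlt hz hMo hGM hw
  refine ⟨hle, hP.eq_of_subset (fun x hx => ⟨_, hPM (snoc_apex_mem_topPiece hlt hx),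
    Fin.init_snoc (α := fun _ => ℝ) _ x⟩) (isOpenMap_init M hMo) (hMc.image _ continuous_init.continuousOn)
    ⟨g, hg, ?_⟩⟩
  rintro _ ⟨w, hw, rfl⟩
  exact (min_eq_left (hle w hw)).symm.trans (hGM w hw)

end Pieces

/-- If `f : ℝ^d → ℝ` is CPA with `p` distinct maximal pieces and
`zmin < inf f ≤ sup f < zmax`, and `s` is the `m`-sawtooth function between `zmin` and
`zmax`, then `h(x, t) = min (f x) (s t)` is CPA with at least `m·p` distinct maximal
pieces. Here `ℝ^(d+1)` is split as `x = Fin.init x` (first `d` coordinates) and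
`t = x (Fin.last d)` (last coordinate). -/
theorem sawtooth_min_maximal_pieces {d : ℕ} (f : (Fin d → ℝ) → ℝ) (hf : IsCPA f)
    (p : ℕ) (Ps : Finset (Set (Fin d → ℝ))) (hPs : ∀ P ∈ Ps, IsMaximalPiece f P)
    (hp : Ps.card = p)
    (zmin zmax : ℝ)
    (hbb : BddBelow (Set.range f)) (hba : BddAbove (Set.range f))
    (hmin : zmin < ⨅ x, f x) (hmax : (⨆ x, f x) < zmax)
    (m : ℕ) (hm : 1 ≤ m)
    (h : (Fin (d + 1) → ℝ) → ℝ)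
    (hh : ∀ x : Fin (d + 1) → ℝ,
      h x = min (f (Fin.init x)) (sawtooth m zmin zmax (x (Fin.last d)))) :
    IsCPA h ∧
      ∃ Qs : Finset (Set (Fin (d + 1) → ℝ)),
        (∀ Q ∈ Qs, IsMaximalPiece h Q) ∧ m * p ≤ Qs.card := by
  classical
  have hgt : ∀ x, zmin < f x := fun x => hmin.trans_le (ciInf_le hbb x)
  have hlt : ∀ x, f x < zmax := fun x => (le_ciSup hba x).trans_lt hmax
  have hz : zmin < zmax := (hgt 0).trans (hlt 0)
  obtain rfl : h = minSawtooth f m zmin zmax := funext hh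
  refine ⟨isCPA_minSawtooth hf hm hgt hlt, ?_⟩
  have hex : ∀ a : Set (Fin d → ℝ) × ℕ, ∃ M, a ∈ Ps ×ˢ Finset.range m →
      IsMaximalPiece (minSawtooth f m zmin zmax) M ∧ topPiece f zmin zmax a.1 a.2 ⊆ M := by
    intro a
    by_cases ha : a ∈ Ps ×ˢ Finset.range m
    · rw [Finset.mem_product, Finset.mem_range] at ha
      obtain ⟨M, hM⟩ := exists_isMaximalPiece_topPiece hf.1 hlt hz.le ha.2 (hPs _ ha.1)
      exact ⟨M, fun _ => hM⟩
    · exact ⟨∅, fun h => absurd h ha⟩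
  choose M hM using hex
  refine ⟨(Ps ×ˢ Finset.range m).image M, fun Q hQ => ?_, ?_⟩
  · obtain ⟨a, ha, rfl⟩ := Finset.mem_image.1 hQ
    exact (hM a ha).1
  rw [Finset.card_image_of_injOn, Finset.card_product, Finset.card_range, hp, mul_comm]
  rintro ⟨P, k⟩ ha ⟨P', k'⟩ ha' hMM
  obtain ⟨hMax, hsub⟩ := hM _ ha
  obtain ⟨-, hsub'⟩ := hM _ ha'
  rw [← hMM] at hsub'
  simp only [Finset.coe_product, Finset.coe_range, mem_prod, Finset.mem_coe, mem_Iio] at ha ha'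
  have hP := hPs P ha.1
  have hP' := hPs P' ha'.1
  obtain ⟨hle, hinit⟩ := hP.of_topPiece_subset hf.1 hm hlt hz ha.2 hMax hsub
  obtain ⟨-, hinit'⟩ := hP'.of_topPiece_subset hf.1 hm hlt hz ha'.2 hMax hsub'
  obtain ⟨x, hx⟩ := hP.2.1.nonempty
  obtain ⟨x', hx'⟩ := hP'.2.1.nonempty
  have hv := hsub (snoc_apex_mem_topPiece hlt hx)
  have hv' := hsub' (snoc_apex_mem_topPiece hlt hx')
  have hpre := hMax.2.1.isPreconnected
  exact Prod.ext (hinit.symm.trans hinit') (le_antisymm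
    (tooth_le_of_isPreconnected hgt hpre hle ha'.2 hv' hv (Fin.snoc_last _ _)
      (Fin.snoc_last _ _))
    (tooth_le_of_isPreconnected hgt hpre hle ha.2 hv hv' (Fin.snoc_last _ _)
      (Fin.snoc_last _ _)))
end
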